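/- Let K ⊆ L ⊆ K̄ be a finite subextension with ring of integers O_L, let ω ∈ Ω¹_{O_L/O_K}, and let I_L ⊆ O_L be the annihilator ideal of ω. Then the annihilator in O_K̄ of the image of ω in Ω¹_{O_K̄/O_K} equals the extended ideal I_L·O_K̄; in particular this annihilator is a principal ideal of O_K̄. -/

import Mathlib

open MvPolynomial in
theorem Algebra.Generators.subsingleton_h1Cotangent_iff {R S ι : Type*} [CommRing R] [CommRing S]
    [Algebra R S] (P : Algebra.Generators R S ι) :
    Subsingleton P.toExtension.H1Cotangent ↔ ∀ g : MvPolynomial ι R, aeval P.val g = 0 →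
      (∀ i, aeval P.val (pderiv i g) = 0) → g ∈ RingHom.ker (aeval (R := R) P.val) ^ 2 := by
  have hker : P.toExtension.ker = RingHom.ker (aeval (R := R) P.val) := P.ker_eq_ker_aeval_val
  have hker2 (g : MvPolynomial ι R) : g ∈ P.toExtension.ker ^ 2 ↔
      g ∈ RingHom.ker (aeval (R := R) P.val) ^ 2 := by rw [hker]; rfl
  rw [Algebra.Extension.subsingleton_h1Cotangent, injective_iff_map_eq_zero]
  constructor
  · intro h g hg hd
    have hg' : g ∈ P.toExtension.ker := by rw [hker]; exact hg
    have := h (Algebra.Extension.Cotangent.mk ⟨g, hg'⟩) (by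
      apply P.cotangentSpaceBasis.repr.injective
      ext i
      rw [Algebra.Extension.cotangentComplex_mk]
      refine (P.cotangentSpaceBasis_repr_one_tmul g i).trans ?_
      simpa using hd i)
    exact (hker2 g).mp ((Algebra.Extension.Cotangent.mk_eq_zero_iff _).mp this)
  · intro h a ha
    obtain ⟨⟨g, hg⟩, rfl⟩ := Algebra.Extension.Cotangent.mk_surjective a
    refine (Algebra.Extension.Cotangent.mk_eq_zero_iff _).mpr ((hker2 g).mpr ?_)
    rw [hker] at hg
    refine h g hg fun i ↦ ?_
    rw [Algebra.Extension.cotangentComplex_mk] at ha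
    refine (P.cotangentSpaceBasis_repr_one_tmul g i).symm.trans ?_
    exact (congrArg (fun z ↦ P.cotangentSpaceBasis.repr z i) ha).trans (by simp)

open MvPolynomial in
theorem Algebra.H1Cotangent.subsingleton_iff {R S : Type*} [CommRing R] [CommRing S]
    [Algebra R S] :
    Subsingleton (Algebra.H1Cotangent R S) ↔ ∀ g : MvPolynomial S R, aeval _root_.id g = 0 →
      (∀ i, aeval _root_.id (pderiv i g) = 0) → g ∈ RingHom.ker (aeval (R := R) (_root_.id : S → S)) ^ 2 :=
  (Algebra.Generators.self R S).subsingleton_h1Cotangent_iff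

open MvPolynomial in
theorem Algebra.H1Cotangent.subsingleton_of_adjoin_singleton_eq_top {R S : Type*} [CommRing R]
    [CommRing S] [Algebra R S] {x : S} (hx : Algebra.adjoin R {x} = ⊤) {f : Polynomial R}
    (hf : RingHom.ker (Polynomial.aeval (R := R) x) = Ideal.span {f})
    (hd : Polynomial.aeval x f.derivative ∈ nonZeroDivisors S) :
    Subsingleton (Algebra.H1Cotangent R S) := by
  have hsurj : Function.Surjective (aeval (R := R) (fun _ : Unit ↦ x)) := by
    rw [← AlgHom.range_eq_top, ← Algebra.adjoin_range_eq_range_aeval, Set.range_const, hx]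
  let P := Algebra.Generators.ofSurjective (fun _ : Unit ↦ x) hsurj
  refine P.equivH1Cotangent.symm.toEquiv.subsingleton_congr.mpr ?_
  rw [Algebra.Generators.subsingleton_h1Cotangent_iff]
  change ∀ g : MvPolynomial Unit R, aeval (fun _ ↦ x) g = 0 →
    (∀ i, aeval (fun _ ↦ x) (pderiv i g) = 0) → g ∈ RingHom.ker (aeval (R := R) fun _ ↦ x) ^ 2
  let e := uniqueAlgEquiv R Unit
  have he (g : MvPolynomial Unit R) : Polynomial.aeval x (e g) = aeval (fun _ ↦ x) g := by
    have : (Polynomial.aeval x).comp (e : MvPolynomial Unit R →ₐ[R] Polynomial R) =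
        aeval (fun _ ↦ x) := by
      ext i; simp [e]
    exact DFunLike.congr_fun this g
  have hX : e (X ()) = Polynomial.X := by simp [e]
  have hpd (g : MvPolynomial Unit R) : e (pderiv () g) = (e g).derivative := by
    induction g using MvPolynomial.induction_on with
    | C a => simp [e]
    | add p q hp hq => simp [hp, hq]
    | mul_X p i hp => simp [Derivation.leibniz, hp, mul_comm, hX]
  intro g hg hg'
  have h1 : e g ∈ Ideal.span {f} := by rw [← hf]; exact (he g).trans hg
  obtain ⟨q, hq⟩ := Ideal.mem_span_singleton'.mp h1
  have hf0 : Polynomial.aeval x f = 0 := by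
    have := Ideal.mem_span_singleton_self f
    rwa [← hf] at this
  have h2 : q ∈ Ideal.span {f} := by
    rw [← hf, RingHom.mem_ker]
    have := hg' ()
    rw [← he, hpd, ← hq, Polynomial.derivative_mul, map_add, map_mul, map_mul, hf0, mul_zero,
      zero_add] at this
    exact (mul_right_mem_nonZeroDivisors_eq_zero_iff hd).mp this
  obtain ⟨r, rfl⟩ := Ideal.mem_span_singleton'.mp h2
  have h3 : g = e.symm r * (e.symm f * e.symm f) := by
    rw [← map_mul, ← map_mul, ← mul_assoc, hq, e.symm_apply_apply]
  rw [h3, sq]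
  have h4 : e.symm f ∈ RingHom.ker (aeval (R := R) fun _ : Unit ↦ x) := by
    rw [RingHom.mem_ker, ← he, e.apply_symm_apply, hf0]
  exact Ideal.mul_mem_left _ _ (Ideal.mul_mem_mul h4 h4)

open MvPolynomial in
theorem Algebra.H1Cotangent.subsingleton_of_forall_finset {R S : Type*} [CommRing R]
    [CommRing S] [Algebra R S] (h : ∀ s : Finset S, ∃ B : Subalgebra R S, (s : Set S) ⊆ B ∧
      Subsingleton (Algebra.H1Cotangent R B)) :
    Subsingleton (Algebra.H1Cotangent R S) := by
  rw [Algebra.H1Cotangent.subsingleton_iff]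
  intro g hg hg'
  obtain ⟨B, hB, hB'⟩ := h g.vars
  rw [Algebra.H1Cotangent.subsingleton_iff] at hB'
  obtain ⟨g, rfl⟩ := exists_rename_eq_of_vars_subset_range g ((↑) : B → S)
    Subtype.val_injective (by simpa using hB)
  have key (q : MvPolynomial B R) : aeval _root_.id (rename ((↑) : B → S) q) = (aeval _root_.id q : B) := by
    rw [aeval_rename]
    exact (MvPolynomial.aeval_algebraMap_apply S (_root_.id : B → B) q)
  have h1 : g ∈ RingHom.ker (aeval (R := R) (_root_.id : B → B)) ^ 2 := by
    refine hB' g ?_ fun i ↦ ?_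
    · simpa [key] using hg
    · have := hg' i
      rw [pderiv_rename Subtype.val_injective, key] at this
      simpa using this
  have h2 := Ideal.mem_map_of_mem (rename (R := R) ((↑) : B → S)) h1
  rw [Ideal.map_pow] at h2
  refine Ideal.pow_right_mono (Ideal.map_le_iff_le_comap.mpr fun q hq ↦ ?_) 2 h2
  rw [Ideal.mem_comap, RingHom.mem_ker, key, hq]
  rfl

open scoped TensorProduct in
theorem Submodule.annihilator_span_one_tmul_of_flat {R S M : Type*} [CommRing R] [CommRing S]
    [Algebra R S] [Module.Flat R S] [AddCommGroup M] [Module R M] (m : M) :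
    (Submodule.span S {(1 : S) ⊗ₜ[R] m}).annihilator =
      ((Submodule.span R {m}).annihilator).map (algebraMap R S) := by
  apply le_antisymm
  · intro b hb
    rw [Submodule.mem_annihilator_span_singleton, TensorProduct.smul_tmul', smul_eq_mul,
      mul_one] at hb
    let f := LinearMap.toSpanSingleton R M m
    have hex := Module.Flat.lTensor_exact S (LinearMap.exact_subtype_ker_map f)
    obtain ⟨t, ht⟩ := (hex (b ⊗ₜ 1)).mp (by simpa [f] using hb)
    have key (t : S ⊗[R] LinearMap.ker f) : TensorProduct.rid R S
        ((LinearMap.ker f).subtype.lTensor S t) ∈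
          ((Submodule.span R {m}).annihilator).map (algebraMap R S) := by
      induction t with
      | zero => simp
      | add x y hx hy => rw [map_add, map_add]; exact add_mem hx hy
      | tmul x y =>
        rw [LinearMap.lTensor_tmul, TensorProduct.rid_tmul, Algebra.smul_def]
        refine Ideal.mul_mem_right _ _ (Ideal.mem_map_of_mem _ ?_)
        rw [Submodule.mem_annihilator_span_singleton]
        exact y.2
    simpa [ht] using key t
  · refine Ideal.map_le_iff_le_comap.mpr fun a ha ↦ ?_
    rw [Submodule.mem_annihilator_span_singleton] at ha
    rw [Ideal.mem_comap, Submodule.mem_annihilator_span_singleton, algebraMap_smul,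
      ← TensorProduct.tmul_smul, ha, TensorProduct.tmul_zero]

open IsLocalRing in
theorem IsDiscreteValuationRing.exists_lift_irreducible_pow_card_sub {B : Type*} [CommRing B]
    [IsDomain B] [IsDiscreteValuationRing B] [Finite (ResidueField B)] (g : ResidueField B) :
    ∃ x : B, residue B x = g ∧ Irreducible (x ^ Nat.card (ResidueField B) - x) := by
  have := Fintype.ofFinite (ResidueField B)
  obtain ⟨ϖ, hϖ⟩ := exists_irreducible B
  obtain ⟨x, hx⟩ := residue_surjective g
  set q := Nat.card (ResidueField B) with hq
  have hpow (a : ResidueField B) : a ^ q = a := by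
    rw [hq, Nat.card_eq_fintype_card, FiniteField.pow_card]
  have hϖ0 : residue B ϖ = 0 := by
    rw [residue_eq_zero_iff, hϖ.maximalIdeal_eq]
    exact Ideal.mem_span_singleton_self ϖ
  have hmem : x ^ q - x ∈ IsLocalRing.maximalIdeal B := by
    rw [← residue_eq_zero_iff, map_sub, map_pow, hpow, sub_self]
  rw [hϖ.maximalIdeal_eq] at hmem
  obtain ⟨c, hc⟩ := Ideal.mem_span_singleton.mp hmem
  by_cases hcu : IsUnit c
  · exact ⟨x, hx, by rw [hc]; exact (irreducible_mul_isUnit hcu).mpr hϖ⟩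
  · obtain ⟨k, hk⟩ := Polynomial.binomExpansion (Polynomial.X ^ q - Polynomial.X) x ϖ
    refine ⟨x + ϖ, by rw [map_add, hϖ0, add_zero, hx], ?_⟩
    simp only [Polynomial.eval_sub, Polynomial.eval_pow, Polynomial.eval_X, hc,
      Polynomial.derivative_sub, Polynomial.derivative_X_pow, Polynomial.derivative_X,
      Polynomial.eval_mul, Polynomial.eval_C, Polynomial.eval_one] at hk
    have : (x + ϖ) ^ q - (x + ϖ) = ϖ * (c + (q * x ^ (q - 1) - 1) + k * ϖ) := by
      rw [hk]; ring
    rw [this]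
    refine (irreducible_mul_isUnit ?_).mpr hϖ
    have hc0 : residue B c = 0 := by
      rw [residue_eq_zero_iff]; exact hcu
    have hq0 : (q : ResidueField B) = 0 := by
      rw [hq, Nat.card_eq_fintype_card, FiniteField.cast_card_eq_zero]
    rw [← residue_ne_zero_iff_isUnit]
    simp [hc0, hϖ0, hq0]

open IsLocalRing in
theorem IsDiscreteValuationRing.exists_adjoin_singleton_eq_top (A : Type*) {B : Type*}
    [CommRing A] [IsLocalRing A] [CommRing B] [IsDomain B] [IsDiscreteValuationRing B]
    [Algebra A B] [FaithfulSMul A B] [Module.Finite A B] [Finite (ResidueField B)]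
    (hA : ¬ IsField A) : ∃ x : B, Algebra.adjoin A {x} = ⊤ := by
  obtain ⟨g, hg⟩ := IsCyclic.exists_monoid_generator (α := (ResidueField B)ˣ)
  obtain ⟨x, hx, hirr⟩ := exists_lift_irreducible_pow_card_sub (g : ResidueField B)
  set ϖ := x ^ Nat.card (ResidueField B) - x
  set N := Algebra.adjoin A {x}
  have hxN : x ∈ N := Algebra.self_mem_adjoin_singleton A x
  have hϖN : ϖ ∈ N := sub_mem (pow_mem hxN _) hxN
  have hres (b : B) : ∃ n ∈ N, ∃ c, b = n + ϖ * c := by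
    have : ∃ n ∈ N, residue B n = residue B b := by
      by_cases hb : residue B b = 0
      · exact ⟨0, zero_mem _, by rw [hb, map_zero]⟩
      · obtain ⟨k, hk⟩ := hg (Units.mk0 _ hb)
        refine ⟨x ^ k, pow_mem hxN k, ?_⟩
        rw [map_pow, hx]
        simpa using congrArg Units.val hk
    obtain ⟨n, hn, h⟩ := this
    have hmem : b - n ∈ IsLocalRing.maximalIdeal B := by rw [← residue_eq_zero_iff, map_sub, h, sub_self]
    rw [hirr.maximalIdeal_eq] at hmem
    obtain ⟨c, hc⟩ := Ideal.mem_span_singleton.mp hmem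
    exact ⟨n, hn, c, by rw [← hc]; ring⟩
  have hpow (k : ℕ) (b : B) : ∃ n ∈ N, ∃ c, b = n + ϖ ^ k * c := by
    induction k generalizing b with
    | zero => exact ⟨0, zero_mem _, b, by simp⟩
    | succ k ih =>
      obtain ⟨n, hn, c, rfl⟩ := ih b
      obtain ⟨m, hm, d, rfl⟩ := hres c
      exact ⟨n + ϖ ^ k * m, add_mem hn (mul_mem (pow_mem hϖN k) hm), d, by ring⟩
  obtain ⟨a, ha, ha0⟩ := Submodule.exists_mem_ne_zero_of_ne_bot
    (mt isField_iff_maximalIdeal_eq.mpr hA)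
  have ha0' : algebraMap A B a ≠ 0 := by
    rwa [Ne, FaithfulSMul.algebraMap_eq_zero_iff]
  obtain ⟨e, he⟩ := associated_pow_irreducible ha0' hirr
  obtain ⟨u, hu⟩ := he
  have hle : (⊤ : Submodule A B) ≤ Subalgebra.toSubmodule N := by
    refine Submodule.le_of_le_smul_of_le_jacobson_bot Module.Finite.fg_top
      (maximalIdeal_le_jacobson ⊥) fun b _ ↦ ?_
    obtain ⟨n, hn, c, rfl⟩ := hpow e b
    refine Submodule.add_mem_sup hn ?_
    rw [← hu, mul_assoc, ← Algebra.smul_def]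
    exact Submodule.smul_mem_smul ha trivial
  exact ⟨x, top_le_iff.mp fun b _ ↦ hle trivial⟩

theorem Padic.isIntegral_iff_spectralNorm_le_one (p : ℕ) [Fact p.Prime] {M : Type*} [Field M]
    [Algebra ℚ_[p] M] [Algebra.IsAlgebraic ℚ_[p] M] [Algebra ℤ_[p] M]
    [IsScalarTower ℤ_[p] ℚ_[p] M] (y : M) :
    IsIntegral ℤ_[p] y ↔ spectralNorm ℚ_[p] M y ≤ 1 := by
  have hy : IsIntegral ℚ_[p] y := Algebra.IsIntegral.isIntegral y
  rw [spectralNorm, spectralValue_le_one_iff (minpoly.monic hy)]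
  constructor
  · intro h n
    rw [minpoly.isIntegrallyClosed_eq_field_fractions' ℚ_[p] h, Polynomial.coeff_map]
    exact ((minpoly ℤ_[p] y).coeff n).2
  · intro h
    have hl : minpoly ℚ_[p] y ∈ Polynomial.lifts (algebraMap ℤ_[p] ℚ_[p]) :=
      (Polynomial.lifts_iff_coeff_lifts _).mpr fun n ↦ ⟨⟨_, h n⟩, rfl⟩
    obtain ⟨f, hf, -, hfm⟩ := Polynomial.lifts_and_degree_eq_and_monic hl (minpoly.monic hy)
    refine ⟨f, hfm, ?_⟩
    rw [← Polynomial.aeval_def, ← Polynomial.aeval_map_algebraMap ℚ_[p], hf, minpoly.aeval]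

theorem PadicInt.isLocalRing_of_isIntegralClosure (p : ℕ) [Fact p.Prime] (M : Type*) [Field M]
    [Algebra ℚ_[p] M] [Algebra ℤ_[p] M] [IsScalarTower ℤ_[p] ℚ_[p] M] (R : Type*) [CommRing R]
    [Algebra R M] [IsIntegralClosure R ℤ_[p] M]
    [Algebra.IsAlgebraic ℚ_[p] M] :
    IsLocalRing R := by
  have hinj := IsIntegralClosure.algebraMap_injective R ℤ_[p] M
  have : Nontrivial R := (algebraMap R M).domain_nontrivial
  let N := spectralMulAlgNorm ℚ_[p] M
  have hint (y : M) : IsIntegral ℤ_[p] y ↔ N y ≤ 1 := Padic.isIntegral_iff_spectralNorm_le_one p y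
  have hle (r : R) : N (algebraMap R M r) ≤ 1 :=
    (hint _).mp ((IsIntegralClosure.isIntegral_iff (A := R)).mpr ⟨r, rfl⟩)
  have hunit (r : R) : IsUnit r ↔ N (algebraMap R M r) = 1 := by
    constructor
    · rintro ⟨u, rfl⟩
      have h : N (algebraMap R M u) * N (algebraMap R M ↑u⁻¹) = 1 := by
        rw [← map_mul, ← map_mul, Units.mul_inv, map_one, map_one]
      nlinarith [hle u, hle ↑u⁻¹, apply_nonneg N (algebraMap R M u)]
    · intro h
      have hr : algebraMap R M r ≠ 0 := by
        intro h0
        rw [h0, map_zero] at h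
        exact zero_ne_one h
      have hinv : N (algebraMap R M r)⁻¹ ≤ 1 := by
        have h' : N (algebraMap R M r) * N (algebraMap R M r)⁻¹ = 1 := by
          rw [← map_mul, mul_inv_cancel₀ hr, map_one]
        rw [h, one_mul] at h'
        exact h'.le
      obtain ⟨s, hs⟩ := (IsIntegralClosure.isIntegral_iff (A := R)).mp ((hint _).mpr hinv)
      refine IsUnit.of_mul_eq_one s (hinj ?_)
      rw [map_mul, hs, mul_inv_cancel₀ hr, map_one]
  refine IsLocalRing.of_nonunits_add fun a b ha hb ↦ ?_
  rw [mem_nonunits_iff, hunit] at ha hb ⊢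
  have h : N (algebraMap R M (a + b)) ≤ max (N (algebraMap R M a)) (N (algebraMap R M b)) := by
    rw [map_add]
    exact isNonarchimedean_spectralNorm _ _
  exact (h.trans_lt (max_lt ((hle a).lt_of_ne ha) ((hle b).lt_of_ne hb))).ne

theorem PadicInt.algebraMap_injective_of_isScalarTower (p : ℕ) [Fact p.Prime] (M : Type*)
    [Field M] [Algebra ℚ_[p] M] [Algebra ℤ_[p] M] [IsScalarTower ℤ_[p] ℚ_[p] M] (R : Type*)
    [CommRing R] [Algebra R M] [Algebra ℤ_[p] R] [IsScalarTower ℤ_[p] R M] :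
    Function.Injective (algebraMap ℤ_[p] R) := by
  refine Function.Injective.of_comp (f := algebraMap R M) ?_
  rw [← RingHom.coe_comp, ← IsScalarTower.algebraMap_eq, IsScalarTower.algebraMap_eq _ ℚ_[p] M]
  exact (algebraMap ℚ_[p] M).injective.comp (IsFractionRing.injective ℤ_[p] ℚ_[p])

theorem PadicInt.isDiscreteValuationRing_of_isIntegralClosure (p : ℕ) [Fact p.Prime] (M : Type*) [Field M]
    [Algebra ℚ_[p] M] [Algebra ℤ_[p] M] [IsScalarTower ℤ_[p] ℚ_[p] M] (R : Type*) [CommRing R]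
    [Algebra R M]
    [Algebra ℤ_[p] R] [IsScalarTower ℤ_[p] R M] [IsIntegralClosure R ℤ_[p] M]
    [FiniteDimensional ℚ_[p] M]
    [IsDomain R] : IsDiscreteValuationRing R := by
  have := PadicInt.isLocalRing_of_isIntegralClosure p M R
  have := IsIntegralClosure.isDedekindDomain ℤ_[p] ℚ_[p] M R
  have hnf : ¬ IsField R := by
    have : Algebra.IsIntegral ℤ_[p] R := IsIntegralClosure.isIntegral_algebra ℤ_[p] M
    have hinj := PadicInt.algebraMap_injective_of_isScalarTower p M R
    exact fun h ↦ IsDiscreteValuationRing.not_isField ℤ_[p]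
      (isField_of_isIntegral_of_isField hinj h)
  exact ((IsDiscreteValuationRing.TFAE R hnf).out 0 2).mpr this

theorem PadicInt.finite_residueField_of_isIntegralClosure (p : ℕ) [Fact p.Prime] (M : Type*) [Field M]
    [Algebra ℚ_[p] M] [Algebra ℤ_[p] M] [IsScalarTower ℤ_[p] ℚ_[p] M] (R : Type*) [CommRing R]
    [Algebra R M]
    [Algebra ℤ_[p] R] [IsScalarTower ℤ_[p] R M] [IsIntegralClosure R ℤ_[p] M]
    [FiniteDimensional ℚ_[p] M] [IsLocalRing R] : Finite (IsLocalRing.ResidueField R) := by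
  have : IsDomain R := (IsIntegralClosure.algebraMap_injective R ℤ_[p] M).isDomain
  have := IsIntegralClosure.finite ℤ_[p] ℚ_[p] M R
  have : Finite (IsLocalRing.ResidueField ℤ_[p]) := .of_equiv _ PadicInt.residueField.symm.toEquiv
  have : FaithfulSMul ℤ_[p] R := (faithfulSMul_iff_algebraMap_injective _ _).mpr
    (PadicInt.algebraMap_injective_of_isScalarTower p M R)
  exact IsLocalRing.ResidueField.finite_of_finite (R := ℤ_[p]) inferInstance


theorem Algebra.H1Cotangent.subsingleton_of_isIntegralClosure_padicInt (p : ℕ) [Fact p.Prime]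
    (L M : Type*) [Field L] [Algebra ℚ_[p] L] [Algebra ℤ_[p] L] [IsScalarTower ℤ_[p] ℚ_[p] L]
    [FiniteDimensional ℚ_[p] L] [Field M] [Algebra ℚ_[p] M] [Algebra ℤ_[p] M]
    [IsScalarTower ℤ_[p] ℚ_[p] M] [FiniteDimensional ℚ_[p] M]
    (A B : Type*) [CommRing A] [Algebra ℤ_[p] A] [Algebra A L] [IsScalarTower ℤ_[p] A L]
    [IsIntegralClosure A ℤ_[p] L] [CommRing B] [Algebra ℤ_[p] B] [Algebra B M]
    [IsScalarTower ℤ_[p] B M] [IsIntegralClosure B ℤ_[p] M]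
    [Algebra A B] [FaithfulSMul A B] [IsScalarTower ℤ_[p] A B] :
    Subsingleton (Algebra.H1Cotangent A B) := by
  have : IsDomain A := (IsIntegralClosure.algebraMap_injective A ℤ_[p] L).isDomain
  have : IsDomain B := (IsIntegralClosure.algebraMap_injective B ℤ_[p] M).isDomain
  have := PadicInt.isDiscreteValuationRing_of_isIntegralClosure p L A
  have := PadicInt.isDiscreteValuationRing_of_isIntegralClosure p M B
  have := PadicInt.finite_residueField_of_isIntegralClosure p M B
  have := IsIntegralClosure.finite ℤ_[p] ℚ_[p] M B
  have : Module.Finite A B := .of_restrictScalars_finite ℤ_[p] A B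
  have : CharZero A :=
    charZero_of_injective_algebraMap (PadicInt.algebraMap_injective_of_isScalarTower p L A)
  obtain ⟨x, hx⟩ := IsDiscreteValuationRing.exists_adjoin_singleton_eq_top A (B := B)
    (IsDiscreteValuationRing.not_isField A)
  have hint : IsIntegral A x := Algebra.IsIntegral.isIntegral x
  refine subsingleton_of_adjoin_singleton_eq_top hx (minpoly.ker_eval hint)
    (mem_nonZeroDivisors_of_ne_zero fun h0 ↦ ?_)
  have hdvd := (minpoly.isIntegrallyClosed_dvd_iff hint _).mp h0
  have hderiv := Polynomial.eq_zero_of_dvd_of_degree_lt hdvd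
    (Polynomial.degree_derivative_lt (minpoly.ne_zero hint))
  exact (minpoly.natDegree_pos hint).ne' (Polynomial.derivative_eq_zero.mp hderiv)

theorem Algebra.H1Cotangent.subsingleton_of_isIntegralClosure_padicInt_of_isAlgebraic (p : ℕ)
    [Fact p.Prime] (L E : Type*) [Field L] [Algebra ℚ_[p] L] [Algebra ℤ_[p] L]
    [IsScalarTower ℤ_[p] ℚ_[p] L] [FiniteDimensional ℚ_[p] L] [Field E] [Algebra ℚ_[p] E]
    [Algebra ℤ_[p] E] [IsScalarTower ℤ_[p] ℚ_[p] E] [Algebra L E] [IsScalarTower ℚ_[p] L E]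
    [Algebra.IsAlgebraic L E] (A C : Type*) [CommRing A] [Algebra ℤ_[p] A] [Algebra A L]
    [IsScalarTower ℤ_[p] A L] [IsIntegralClosure A ℤ_[p] L] [CommRing C] [Algebra ℤ_[p] C]
    [Algebra C E] [IsScalarTower ℤ_[p] C E] [IsIntegralClosure C ℤ_[p] E]
    [Algebra A C] [FaithfulSMul A C] [IsScalarTower ℤ_[p] A C] [Algebra A E]
    [IsScalarTower A L E] [IsScalarTower A C E] :
    Subsingleton (Algebra.H1Cotangent A C) := by
  refine Algebra.H1Cotangent.subsingleton_of_forall_finset fun s ↦ ?_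
  let M := IntermediateField.adjoin L (algebraMap C E '' s)
  have : FiniteDimensional L M := IntermediateField.finiteDimensional_adjoin
    fun y _ ↦ Algebra.IsIntegral.isIntegral y
  have : FiniteDimensional ℚ_[p] M := .trans ℚ_[p] L M
  have htower : IsScalarTower ℤ_[p] L E := .to₁₃₄ ℤ_[p] ℚ_[p] L E
  have : IsScalarTower ℤ_[p] M E := ⟨fun r m e ↦ smul_assoc r (m : E) e⟩
  have : IsScalarTower ℚ_[p] M E := ⟨fun r m e ↦ smul_assoc r (m : E) e⟩
  have : IsScalarTower ℤ_[p] ℚ_[p] M := .of_algebraMap_eq fun r ↦ Subtype.ext <| by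
    rw [← IntermediateField.algebraMap_apply, ← IsScalarTower.algebraMap_apply ℤ_[p] M E,
      IsScalarTower.algebraMap_apply ℤ_[p] ℚ_[p] E, IsScalarTower.algebraMap_apply ℚ_[p] M E]
    rfl
  let B : Subalgebra A C := (M.toSubalgebra.restrictScalars A).comap (IsScalarTower.toAlgHom A C E)
  let _ : Algebra B M := (((algebraMap C E).comp (algebraMap B C)).codRestrict M.toSubfield
    fun b ↦ b.2).toAlgebra
  have hBM (b : B) : (algebraMap B M b : E) = algebraMap C E b := rfl
  have hM (r : ℤ_[p]) : (algebraMap ℤ_[p] M r : E) = algebraMap ℤ_[p] E r :=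
    (IsScalarTower.algebraMap_apply ℤ_[p] M E r).symm
  have : IsScalarTower ℤ_[p] B M := .of_algebraMap_eq fun r ↦ Subtype.ext <| by
    rw [hM, hBM, IsScalarTower.algebraMap_apply ℤ_[p] C E]
    congr 1
  have : IsIntegralClosure B ℤ_[p] M :=
    { algebraMap_injective := fun b c h ↦ Subtype.ext <|
        IsIntegralClosure.algebraMap_injective C ℤ_[p] E (congrArg Subtype.val h)
      isIntegral_iff := fun {y} ↦ by
        rw [← isIntegral_algebraMap_iff (algebraMap M E).injective,
          IsIntegralClosure.isIntegral_iff (A := C)]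
        constructor
        · rintro ⟨c, hc⟩
          exact ⟨⟨c, show algebraMap C E c ∈ M from hc ▸ y.2⟩, Subtype.ext hc⟩
        · rintro ⟨b, rfl⟩
          exact ⟨b, rfl⟩ }
  have : FaithfulSMul A B := (faithfulSMul_iff_algebraMap_injective _ _).mpr fun a b h ↦
    FaithfulSMul.algebraMap_injective A C (congrArg Subtype.val h)
  exact ⟨B, fun c hc ↦ IntermediateField.subset_adjoin L _ ⟨c, hc, rfl⟩,
    subsingleton_of_isIntegralClosure_padicInt p L M A B⟩


/-- With `K ⊆ L ⊆ K̄` a finite subextension of a finite extension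
`K` of `ℚ_p`, rings of integers `O_K ⊆ O_L ⊆ O_K̄`, and `ω ∈ Ω¹_{O_L/O_K}` with
annihilator `I_L ⊆ O_L`: the annihilator in `O_K̄` of the image of `ω` in
`Ω¹_{O_K̄/O_K}` equals the extended ideal `I_L · O_K̄`; in particular it is a
principal ideal of `O_K̄`. -/
theorem annihilator_image_kaehler_eq_map_annihilator
    (p : ℕ) [Fact p.Prime]
    (K : Type*) [Field K] [Algebra ℚ_[p] K] [FiniteDimensional ℚ_[p] K]
    (Kbar : Type*) [Field Kbar] [Algebra K Kbar] [IsAlgClosure K Kbar]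
    [Algebra ℤ_[p] K] [IsScalarTower ℤ_[p] ℚ_[p] K]
    [Algebra ℚ_[p] Kbar] [Algebra ℤ_[p] Kbar]
    [IsScalarTower ℤ_[p] ℚ_[p] Kbar] [IsScalarTower ℚ_[p] K Kbar]
    (L : Type*) [Field L] [Algebra K L] [FiniteDimensional K L]
    [Algebra ℤ_[p] L] [Algebra ℚ_[p] L] [IsScalarTower ℤ_[p] ℚ_[p] L]
    [IsScalarTower ℚ_[p] K L]
    [Algebra L Kbar] [IsScalarTower K L Kbar]
    (OK : Type*) [CommRing OK] [Algebra ℤ_[p] OK] [Algebra OK K]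
    [IsScalarTower ℤ_[p] OK K] [IsIntegralClosure OK ℤ_[p] K]
    (OL : Type*) [CommRing OL] [Algebra ℤ_[p] OL] [Algebra OL L]
    [IsScalarTower ℤ_[p] OL L] [IsIntegralClosure OL ℤ_[p] L]
    (OKbar : Type*) [CommRing OKbar] [Algebra ℤ_[p] OKbar] [Algebra OKbar Kbar]
    [IsScalarTower ℤ_[p] OKbar Kbar] [IsIntegralClosure OKbar ℤ_[p] Kbar]
    [Algebra OK OL] [Algebra OK L] [IsScalarTower OK K L] [IsScalarTower OK OL L]
    [Algebra OL OKbar] [Algebra OL Kbar] [IsScalarTower OL L Kbar]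
    [IsScalarTower OL OKbar Kbar]
    [Algebra OK OKbar] [Algebra OK Kbar] [IsScalarTower OK K Kbar]
    [IsScalarTower OK OKbar Kbar] [IsScalarTower OK OL OKbar]
    (ω : KaehlerDifferential OK OL) :
    (Submodule.span OKbar {KaehlerDifferential.map OK OK OL OKbar ω}).annihilator =
      Ideal.map (algebraMap OL OKbar) (Submodule.span OL {ω}).annihilator ∧
    ((Submodule.span OKbar
      {KaehlerDifferential.map OK OK OL OKbar ω}).annihilator).IsPrincipal := by
  have : FiniteDimensional ℚ_[p] L := .trans ℚ_[p] K L
  have : Algebra.IsAlgebraic K Kbar := IsAlgClosure.isAlgebraic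
  have : Algebra.IsAlgebraic L Kbar := .tower_top (K := K) L
  have : IsScalarTower ℚ_[p] L Kbar := .to₁₃₄ ℚ_[p] K L Kbar
  have hinjC := IsIntegralClosure.algebraMap_injective OKbar ℤ_[p] Kbar
  have : IsScalarTower ℤ_[p] L Kbar := .to₁₃₄ ℤ_[p] ℚ_[p] L Kbar
  have : IsScalarTower ℤ_[p] OL OKbar := .of_algebraMap_eq fun r ↦ hinjC <| by
    rw [← IsScalarTower.algebraMap_apply ℤ_[p] OKbar Kbar,
      ← IsScalarTower.algebraMap_apply OL OKbar Kbar, IsScalarTower.algebraMap_apply OL L Kbar,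
      ← IsScalarTower.algebraMap_apply ℤ_[p] OL L, ← IsScalarTower.algebraMap_apply ℤ_[p] L Kbar]
  have hinjL := IsIntegralClosure.algebraMap_injective OL ℤ_[p] L
  have : FaithfulSMul OL OKbar := (faithfulSMul_iff_algebraMap_injective _ _).mpr <| by
    refine Function.Injective.of_comp (f := algebraMap OKbar Kbar) ?_
    rw [← RingHom.coe_comp, ← IsScalarTower.algebraMap_eq, IsScalarTower.algebraMap_eq OL L Kbar]
    exact (algebraMap L Kbar).injective.comp hinjL
  have : IsDomain OL := hinjL.isDomain
  have : IsDomain OKbar := hinjC.isDomain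
  have := PadicInt.isDiscreteValuationRing_of_isIntegralClosure p L OL
  have : Subsingleton (Algebra.H1Cotangent OL OKbar) :=
    Algebra.H1Cotangent.subsingleton_of_isIntegralClosure_padicInt_of_isAlgebraic
      p L Kbar OL OKbar
  have hinj : Function.Injective (KaehlerDifferential.mapBaseChange OK OL OKbar) := by
    rw [injective_iff_map_eq_zero]
    intro t ht
    obtain ⟨z, rfl⟩ := (Algebra.H1Cotangent.exact_δ_mapBaseChange OK OL OKbar t).mp ht
    rw [Subsingleton.elim z 0, map_zero]
  have hann : (Submodule.span OKbar {KaehlerDifferential.map OK OK OL OKbar ω}).annihilator =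
      Ideal.map (algebraMap OL OKbar) (Submodule.span OL {ω}).annihilator := by
    rw [← Submodule.annihilator_span_one_tmul_of_flat]
    ext b
    rw [Submodule.mem_annihilator_span_singleton, Submodule.mem_annihilator_span_singleton,
      ← hinj.eq_iff, map_smul, map_zero, KaehlerDifferential.mapBaseChange_tmul, one_smul]
  refine ⟨hann, ?_⟩
  obtain ⟨a, ha⟩ := IsPrincipalIdealRing.principal (Submodule.span OL {ω}).annihilator
  rw [hann, ha, Ideal.submodule_span_eq, Ideal.map_span, Set.image_singleton]
  exact ⟨_, rfl⟩
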